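/- arXiv:0905.3553 — 6 statements merged into one kernel-verified Lean document; each statement's English description precedes it below -/
import Mathlib

section
/- The fundamental equation for a zero-pressure Weyl-type Newton–Coulomb fluid: let φ : E → ℝ be twice continuously differentiable on an open set U ⊆ E, f : ℝ → ℝ twice continuously differentiable, and let ρ_m, ρ_e : E → ℝ and constants S > 0, G > 0 be such that on U the Poisson equations Δ(f ∘ φ) = S·G·ρ_m and Δφ = −S·ρ_e hold together with the equilibrium condition ρ_m·f'(φ) + ρ_e = 0. Then for every x ∈ U, (f'(φ(x))² − G)·Δφ(x) + f'(φ(x))·f''(φ(x))·‖∇φ(x)‖² = 0. -/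
open RealInnerProductSpace

/-- The Laplacian of a scalar function on Euclidean space: the trace of the second
derivative over the standard orthonormal basis. -/
noncomputable def laplacian {n : ℕ} (g : EuclideanSpace ℝ (Fin n) → ℝ)
    (x : EuclideanSpace ℝ (Fin n)) : ℝ :=
  ∑ i : Fin n,
    iteratedFDeriv ℝ 2 g x ![EuclideanSpace.single i 1, EuclideanSpace.single i 1]

/-- Chain rule for the second derivative along a direction. -/
theorem second_deriv_comp_aux {n : ℕ} (φ : EuclideanSpace ℝ (Fin n) → ℝ) (f : ℝ → ℝ)
    (x v : EuclideanSpace ℝ (Fin n)) (hφ : ContDiffAt ℝ 2 φ x) (hf : ContDiff ℝ 2 f) :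
    iteratedFDeriv ℝ 2 (f ∘ φ) x ![v, v]
      = deriv f (φ x) * iteratedFDeriv ℝ 2 φ x ![v, v]
        + deriv (deriv f) (φ x) * (fderiv ℝ φ x v) ^ 2 := by
  have hfd : Differentiable ℝ f := hf.differentiable (by norm_num)
  have hf' : Differentiable ℝ (deriv f) := by
    have h : ContDiff ℝ (1 + 1) f := by simpa [one_add_one_eq_two] using hf
    exact ((contDiff_succ_iff_deriv.1 h).2.2).differentiable (by norm_num)
  have hev : ∀ᶠ y in nhds x, DifferentiableAt ℝ φ y := by
    filter_upwards [hφ.eventually (by simp)] with y hy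
    exact hy.differentiableAt (by norm_num)
  have hE : fderiv ℝ (f ∘ φ) =ᶠ[nhds x] fun y => deriv f (φ y) • fderiv ℝ φ y := by
    filter_upwards [hev] with y hy
    exact ((hfd (φ y)).hasDerivAt.comp_hasFDerivAt y hy.hasFDerivAt).fderiv
  have hφx : HasFDerivAt φ (fderiv ℝ φ x) x := hev.self_of_nhds.hasFDerivAt
  have hdφ : DifferentiableAt ℝ (fderiv ℝ φ) x :=
    (hφ.fderiv_right (m := 1) (by norm_num [one_add_one_eq_two])).differentiableAt (by norm_num)
  have h1 : HasFDerivAt (fun y => deriv f (φ y))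
      (deriv (deriv f) (φ x) • fderiv ℝ φ x) x :=
    (hf' (φ x)).hasDerivAt.comp_hasFDerivAt x hφx
  have h2 := (h1.smul hdφ.hasFDerivAt).fderiv
  rw [iteratedFDeriv_two_apply, iteratedFDeriv_two_apply, hE.fderiv_eq]
  erw [h2]
  simp
  ring

/-- The squared norm of the gradient in coordinates. -/
theorem norm_gradient_sq_aux {n : ℕ} (φ : EuclideanSpace ℝ (Fin n) → ℝ)
    (x : EuclideanSpace ℝ (Fin n)) :
    ‖gradient φ x‖ ^ 2 = ∑ i : Fin n, (fderiv ℝ φ x (EuclideanSpace.single i 1)) ^ 2 := by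
  rw [EuclideanSpace.norm_sq_eq]
  refine Finset.sum_congr rfl fun i _ => ?_
  have h : inner ℝ (gradient φ x) (EuclideanSpace.single i (1 : ℝ))
      = fderiv ℝ φ x (EuclideanSpace.single i 1) := by
    simp only [gradient, InnerProductSpace.toDual_symm_apply]
  rw [← h, EuclideanSpace.inner_single_right]
  simp

/-- the fundamental equation for a zero-pressure Weyl-type
Newton–Coulomb fluid: from the Poisson equations `Δ(f∘φ) = S·G·ρ_m`, `Δφ = −S·ρ_e`
and the equilibrium condition `ρ_m·f'(φ) + ρ_e = 0` one gets
`(f'(φ)² − G)·Δφ + f'(φ)·f''(φ)·‖∇φ‖² = 0` on `U`. -/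
theorem weyl_dust_fundamental_equation {n : ℕ} (hn : 1 ≤ n)
    (U : Set (EuclideanSpace ℝ (Fin n))) (hU : IsOpen U)
    (φ ρm ρe : EuclideanSpace ℝ (Fin n) → ℝ) (f : ℝ → ℝ) (S G : ℝ)
    (hS : 0 < S) (hG : 0 < G)
    (hφ : ContDiffOn ℝ 2 φ U) (hf : ContDiff ℝ 2 f)
    (hpoisV : ∀ x ∈ U, laplacian (f ∘ φ) x = S * G * ρm x)
    (hpoisφ : ∀ x ∈ U, laplacian φ x = -(S * ρe x))
    (heq : ∀ x ∈ U, ρm x * deriv f (φ x) + ρe x = 0) :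
    ∀ x ∈ U,
      (deriv f (φ x) ^ 2 - G) * laplacian φ x
        + deriv f (φ x) * deriv (deriv f) (φ x) * ‖gradient φ x‖ ^ 2 = 0 := by
  intro x hx
  have hφx : ContDiffAt ℝ 2 φ x := hφ.contDiffAt (hU.mem_nhds hx)
  have key : laplacian (f ∘ φ) x
      = deriv f (φ x) * laplacian φ x + deriv (deriv f) (φ x) * ‖gradient φ x‖ ^ 2 := by
    rw [norm_gradient_sq_aux]
    simp only [laplacian, Finset.mul_sum]
    rw [← Finset.sum_add_distrib]
    exact Finset.sum_congr rfl fun i _ => second_deriv_comp_aux φ f x _ hφx hf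
  have hV := hpoisV x hx
  have hp := hpoisφ x hx
  have he := heq x hx
  rw [key] at hV
  linear_combination deriv f (φ x) * hV - G * hp + S * G * he
end

section
/- Divergence form of the fundamental equation: let φ : E → ℝ be twice continuously differentiable on an open set U ⊆ E, f : ℝ → ℝ twice continuously differentiable, and Z : ℝ → ℝ continuously differentiable with Z(t)² = f'(t)² − G for all t (G a real constant). Then for every x ∈ U, Z(φ(x)) · div( y ↦ Z(φ(y)) • ∇φ(y) )(x) = (f'(φ(x))² − G)·Δφ(x) + f'(φ(x))·f''(φ(x))·‖∇φ(x)‖². -/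
open RealInnerProductSpace

/-- The divergence of a vector field on Euclidean space: the trace of its derivative,
`div X (x) = ∑ i ⟪eᵢ, (fderiv ℝ X x) eᵢ⟫` over the standard orthonormal basis. -/
noncomputable def diver {n : ℕ}
    (X : EuclideanSpace ℝ (Fin n) → EuclideanSpace ℝ (Fin n))
    (x : EuclideanSpace ℝ (Fin n)) : ℝ :=
  ∑ i : Fin n, ⟪(EuclideanSpace.single i (1 : ℝ)), fderiv ℝ X x (EuclideanSpace.single i 1)⟫

/-- divergence form of the fundamental equation: if `Z(t)² = f'(t)² − G`
then `Z(φ)·div(Z(φ)•∇φ) = (f'(φ)² − G)·Δφ + f'(φ)·f''(φ)·‖∇φ‖²` on `U`. -/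
theorem weyl_divergence_form {n : ℕ} (hn : 1 ≤ n)
    (U : Set (EuclideanSpace ℝ (Fin n))) (hU : IsOpen U)
    (φ : EuclideanSpace ℝ (Fin n) → ℝ) (f Z : ℝ → ℝ) (G : ℝ)
    (hφ : ContDiffOn ℝ 2 φ U) (hf : ContDiff ℝ 2 f) (hZ : ContDiff ℝ 1 Z)
    (hZsq : ∀ t : ℝ, Z t ^ 2 = deriv f t ^ 2 - G) :
    ∀ x ∈ U,
      Z (φ x) * diver (fun y => Z (φ y) • gradient φ y) x
        = (deriv f (φ x) ^ 2 - G) * laplacian φ x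
          + deriv f (φ x) * deriv (deriv f) (φ x) * ‖gradient φ x‖ ^ 2 := by
  intro x hx
  have hφx : ContDiffAt ℝ 2 φ x := hφ.contDiffAt (hU.mem_nhds hx)
  have hd : HasFDerivAt φ (fderiv ℝ φ x) x :=
    (hφx.differentiableAt (by norm_num)).hasFDerivAt
  have hdd : HasFDerivAt (fderiv ℝ φ) (fderiv ℝ (fderiv ℝ φ) x) x :=
    ((hφx.fderiv_right (m := 1) (by norm_num)).differentiableAt (by norm_num)).hasFDerivAt
  have hZ1 : ∀ t, HasDerivAt Z (deriv Z t) t := fun t =>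
    (hZ.differentiable (by norm_num) t).hasDerivAt
  have hf1 : ∀ t, HasDerivAt (deriv f) (deriv (deriv f) t) t := fun t =>
    ((hf.differentiable_deriv_two) t).hasDerivAt
  have hZZ : ∀ t, Z t * deriv Z t = deriv f t * deriv (deriv f) t := by
    intro t
    have h1 := (hZ1 t).pow 2
    have h2 := ((hf1 t).pow 2).sub_const G
    have h3 : (Z ^ 2 : ℝ → ℝ) = fun t => (deriv f ^ 2 : ℝ → ℝ) t - G := by
      funext s; simpa using hZsq s
    rw [h3] at h1
    have := h1.unique h2
    norm_num at this
    linarith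
  have hgc : ∀ y i, gradient φ y i = fderiv ℝ φ y (EuclideanSpace.single i 1) := by
    intro y i
    have h : ⟪gradient φ y, EuclideanSpace.single i (1 : ℝ)⟫
        = fderiv ℝ φ y (EuclideanSpace.single i 1) := by
      simp [gradient]
    rw [← h, EuclideanSpace.inner_single_right]
    simp
  have hc : ∀ i, HasFDerivAt (fun y => (Z (φ y) • gradient φ y) i)
      (Z (φ x) • ((fderiv ℝ (fderiv ℝ φ) x).flip (EuclideanSpace.single i 1))
        + (fderiv ℝ φ x (EuclideanSpace.single i 1)) • (deriv Z (φ x) • fderiv ℝ φ x)) x := by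
    intro i
    have h1 : HasFDerivAt (fun y => Z (φ y)) (deriv Z (φ x) • fderiv ℝ φ x) x :=
      (hZ1 (φ x)).comp_hasFDerivAt x hd
    have h2 : HasFDerivAt (fun y => fderiv ℝ φ y (EuclideanSpace.single i (1 : ℝ)))
        ((fderiv ℝ (fderiv ℝ φ) x).flip (EuclideanSpace.single i 1)) x := by
      have := hdd.clm_apply (hasFDerivAt_const (EuclideanSpace.single i (1 : ℝ)) x)
      simpa using this
    have h3 := h1.mul h2
    have h4 : (fun y => (Z (φ y) • gradient φ y) i)
        = (fun y => Z (φ y) * fderiv ℝ φ y (EuclideanSpace.single i (1 : ℝ))) := by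
      funext y
      rw [← hgc]; simp
    rw [h4]
    exact h3
  have hX : DifferentiableAt ℝ (fun y => Z (φ y) • gradient φ y) x :=
    (differentiableAt_euclidean).2 fun i => (hc i).differentiableAt
  have hterm : ∀ i : Fin n, ⟪(EuclideanSpace.single i (1 : ℝ)),
      fderiv ℝ (fun y => Z (φ y) • gradient φ y) x (EuclideanSpace.single i 1)⟫
      = Z (φ x) * iteratedFDeriv ℝ 2 φ x ![EuclideanSpace.single i 1, EuclideanSpace.single i 1]
        + deriv Z (φ x) * (gradient φ x i) ^ 2 := by
    intro i
    have h1 := ((EuclideanSpace.proj (𝕜 := ℝ) i).hasFDerivAt.comp x hX.hasFDerivAt).unique (hc i)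
    have h2 := congrArg (fun L => L (EuclideanSpace.single i (1 : ℝ))) h1
    rw [EuclideanSpace.inner_single_left, iteratedFDeriv_two_apply, hgc]
    simp at h2 ⊢
    rw [h2]
    ring
  have hn2 : ‖gradient φ x‖ ^ 2 = ∑ i, (gradient φ x i) ^ 2 := by
    rw [EuclideanSpace.norm_sq_eq]; simp
  have hdiv : diver (fun y => Z (φ y) • gradient φ y) x
      = Z (φ x) * laplacian φ x + deriv Z (φ x) * ‖gradient φ x‖ ^ 2 := by
    rw [hn2]
    simp only [diver, laplacian]
    rw [Finset.sum_congr rfl fun i _ => hterm i, Finset.sum_add_distrib,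
      Finset.mul_sum, Finset.mul_sum]
  rw [hdiv, ← hZsq, ← hZZ]
  ring
end

section
/- Bonnor's theorem for constant charge-to-mass ratio (d-dimensional version): let U ⊆ E be a connected open set, V, φ : E → ℝ twice continuously differentiable on U, ρ_m, ρ_e : E → ℝ, and S > 0, G > 0, K real constants. Suppose on U: the Poisson equations ΔV = S·G·ρ_m and Δφ = −S·ρ_e hold; the dust equilibrium equation ρ_m(x) • ∇V(x) + ρ_e(x) • ∇φ(x) = 0 holds; ρ_e(x) = K·ρ_m(x); and ρ_m(x) ≠ 0 for every x ∈ U. Then K² = G (so K = √G or K = −√G), and there is a constant γ such that V(x) = −K·φ(x) + γ for every x ∈ U. -/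
open RealInnerProductSpace

/-- Bonnor's theorem for constant charge-to-mass ratio,
d-dimensional version: for a static charged dust fluid obeying the Poisson equations
and the equilibrium equation on a connected open set `U`, if `ρ_e = K·ρ_m` with
`ρ_m ≠ 0` on `U`, then `K² = G` and `V = −K·φ + γ` on `U` for some constant `γ`. -/
theorem bonnor_constant_ratio {n : ℕ} (hn : 1 ≤ n)
    (U : Set (EuclideanSpace ℝ (Fin n))) (hU : IsOpen U) (hUconn : IsConnected U)
    (V φ ρm ρe : EuclideanSpace ℝ (Fin n) → ℝ) (S G K : ℝ)
    (hS : 0 < S) (hG : 0 < G)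
    (hV : ContDiffOn ℝ 2 V U) (hφ : ContDiffOn ℝ 2 φ U)
    (hpoisV : ∀ x ∈ U, laplacian V x = S * G * ρm x)
    (hpoisφ : ∀ x ∈ U, laplacian φ x = -(S * ρe x))
    (heq : ∀ x ∈ U, ρm x • gradient V x + ρe x • gradient φ x = 0)
    (hK : ∀ x ∈ U, ρe x = K * ρm x)
    (hρm : ∀ x ∈ U, ρm x ≠ 0) :
    K ^ 2 = G ∧ ∃ γ : ℝ, ∀ x ∈ U, V x = -K * φ x + γ := by
  have hfd : ∀ x ∈ U, fderiv ℝ V x = (-K) • fderiv ℝ φ x := by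
    intro x hx
    have h1 := heq x hx
    rw [hK x hx, mul_comm K, mul_smul, ← smul_add] at h1
    have h2 := (smul_eq_zero.mp h1).resolve_left (hρm x hx)
    unfold gradient at h2
    have h3 : fderiv ℝ V x + K • fderiv ℝ φ x = 0 := by
      apply (InnerProductSpace.toDual ℝ (EuclideanSpace ℝ (Fin n))).symm.injective
      rw [map_add, map_zero, ← h2]
      simp
    rw [neg_smul]
    exact eq_neg_of_add_eq_zero_left h3
  have hdV : DifferentiableOn ℝ V U := hV.differentiableOn (by norm_num)
  have hdφ : DifferentiableOn ℝ φ U := hφ.differentiableOn (by norm_num)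
  constructor
  · obtain ⟨x, hx⟩ := hUconn.nonempty
    have hev : fderiv ℝ V =ᶠ[nhds x] fun y => (-K) • fderiv ℝ φ y := by
      filter_upwards [hU.mem_nhds hx] with y hy using hfd y hy
    have hlap : laplacian V x = -K * laplacian φ x := by
      unfold laplacian
      rw [Finset.mul_sum]
      refine Finset.sum_congr rfl fun i _ => ?_
      have hd : DifferentiableAt ℝ (fderiv ℝ φ) x :=
        ((hφ.contDiffAt (hU.mem_nhds hx)).fderiv_right (m := 1) (by norm_num)).differentiableAt
          (by norm_num)
      rw [iteratedFDeriv_two_apply, iteratedFDeriv_two_apply, hev.fderiv_eq,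
        fderiv_fun_const_smul hd]
      simp
    rw [hpoisV x hx, hpoisφ x hx, hK x hx] at hlap
    have : S * ρm x * (K ^ 2 - G) = 0 := by linear_combination -hlap
    have h := (mul_eq_zero.mp this).resolve_left (mul_ne_zero hS.ne' (hρm x hx))
    linarith
  · obtain ⟨a, ha⟩ := hU.exists_is_const_of_fderiv_eq_zero (𝕜 := ℝ) (f := fun x => V x + K • φ x)
      hUconn.isPreconnected (hdV.add (hdφ.const_smul K)) (by
        intro x hx
        have h1 := hdV.differentiableAt (hU.mem_nhds hx)
        have h2 := hdφ.differentiableAt (hU.mem_nhds hx)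
        rw [fderiv_fun_add h1 (h2.fun_const_smul K), fderiv_fun_const_smul h2, hfd x hx]
        simp)
    refine ⟨a, fun x hx => ?_⟩
    have := ha x hx
    simp only [smul_eq_mul] at this
    linarith
end

section
/- Converse Gautreau–Hoffman theorem in the Newton–Coulomb theory: let U ⊆ E be a bounded open set, V, φ : E → ℝ twice continuously differentiable on U and continuous on the closure of U, ρ_m, ρ_e : E → ℝ, S > 0, G > 0, β, γ real constants, ε ∈ {−1, 1}. Suppose on U the Poisson equations ΔV = S·G·ρ_m and Δφ = −S·ρ_e hold and the densities satisfy β·ρ_e = ε·√G·ρ_m, and suppose V(x) + ε·β·√G·φ(x) − γ = 0 for every x in the frontier of U. Then V(x) + ε·β·√G·φ(x) = γ for every x ∈ U. -/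
open RealInnerProductSpace

theorem gh_second_deriv {E : Type*} [NormedAddCommGroup E] [InnerProductSpace ℝ E]
    (w : E → ℝ) (y v : E)
    (δ : ℝ) (hw : ContDiffAt ℝ 2 w y) (hm : IsLocalMax (fun x => w x + δ * ‖x‖ ^ 2) y) :
    iteratedFDeriv ℝ 2 w y ![v, v] + 2 * δ * ‖v‖ ^ 2 ≤ 0 := by
  by_contra! hpos
  set f : ℝ → ℝ := fun t => w (y + t • v) + δ * (‖y‖ ^ 2 + 2 * t * inner ℝ y v + t ^ 2 * ‖v‖ ^ 2)
    with hf
  have hline : ∀ t : ℝ, HasDerivAt (fun t : ℝ => y + t • v) v t := fun t => by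
    simpa using ((hasDerivAt_id t).smul_const v).const_add y
  have hc : Filter.Tendsto (fun t : ℝ => y + t • v) (nhds 0) (nhds y) := by
    have := (hline 0).continuousAt.tendsto
    simpa using this
  have hfeq : f = fun t => w (y + t • v) + δ * ‖y + t • v‖ ^ 2 := by
    funext t
    simp only [hf]
    rw [norm_add_sq_real, inner_smul_right, norm_smul, mul_pow, Real.norm_eq_abs, sq_abs]
    ring
  have hmax : IsLocalMax f 0 := by
    have := hc.eventually hm
    rw [hfeq]
    filter_upwards [this] with t ht
    simpa using ht
  have hev : ∀ᶠ x in nhds y, DifferentiableAt ℝ w x := by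
    filter_upwards [hw.eventually (by simp)] with x hx
    exact hx.differentiableAt (by simp)
  have hd : ∀ᶠ t in nhds (0 : ℝ), HasDerivAt f
      (fderiv ℝ w (y + t • v) v + δ * (2 * inner ℝ y v + 2 * t * ‖v‖ ^ 2)) t := by
    filter_upwards [hc.eventually hev] with t ht
    have h1 := ht.hasFDerivAt.comp_hasDerivAt t (hline t)
    have h2 : HasDerivAt (fun t : ℝ => δ * (‖y‖ ^ 2 + 2 * t * inner ℝ y v + t ^ 2 * ‖v‖ ^ 2))
        (δ * (2 * inner ℝ y v + 2 * t * ‖v‖ ^ 2)) t := by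
      have h3 := (((((hasDerivAt_id' t).const_mul 2).mul_const (inner ℝ y v)).const_add
        (‖y‖ ^ 2)).add ((hasDerivAt_pow 2 t).mul_const (‖v‖ ^ 2))).const_mul δ
      exact h3.congr_deriv (by simp)
    exact h1.add h2
  have hderiv : deriv f =ᶠ[nhds 0] fun t =>
      fderiv ℝ w (y + t • v) v + δ * (2 * inner ℝ y v + 2 * t * ‖v‖ ^ 2) :=
    hd.mono fun t ht => ht.deriv
  have hdd : deriv (deriv f) 0 = iteratedFDeriv ℝ 2 w y ![v, v] + 2 * δ * ‖v‖ ^ 2 := by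
    rw [hderiv.deriv_eq, iteratedFDeriv_two_apply]
    have hD : DifferentiableAt ℝ (fderiv ℝ w) (y + (0 : ℝ) • v) := by
      have h0 : ContDiffAt ℝ 1 (fderiv ℝ w) y := hw.fderiv_right (by norm_num)
      rw [zero_smul, add_zero]
      exact h0.differentiableAt (by simp)
    have h0 : HasDerivAt (fun t : ℝ => fderiv ℝ w (y + t • v))
        (fderiv ℝ (fderiv ℝ w) (y + (0 : ℝ) • v) v) 0 :=
      hD.hasFDerivAt.comp_hasDerivAt (0 : ℝ) (hline 0)
    have h1 := h0.clm_apply (hasDerivAt_const (0 : ℝ) v)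
    have h2 : HasDerivAt (fun t : ℝ => δ * (2 * inner ℝ y v + 2 * t * ‖v‖ ^ 2))
        (2 * δ * ‖v‖ ^ 2) 0 := by
      have h3 := ((((hasDerivAt_id' (0 : ℝ)).const_mul 2).mul_const (‖v‖ ^ 2)).const_add
        (2 * inner ℝ y v)).const_mul δ
      exact h3.congr_deriv (by ring)
    have h1' : HasDerivAt (fun t : ℝ => fderiv ℝ w (y + t • v) v)
        (fderiv ℝ (fderiv ℝ w) y v v) 0 := by
      refine h1.congr_deriv ?_
      simp
    exact (h1'.add h2).deriv
  have hd0 : deriv f 0 = 0 := hmax.deriv_eq_zero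
  have hmin : IsLocalMin f 0 := isLocalMin_of_deriv_deriv_pos (by rw [hdd]; exact hpos) hd0
    hd.self_of_nhds.continuousAt
  have hconst : f =ᶠ[nhds 0] fun _ => f 0 := by
    filter_upwards [hmax, hmin] with t h1 h2
    exact le_antisymm h1 h2
  have : deriv (deriv f) 0 = 0 := by
    rw [hconst.deriv.deriv_eq]
    simp
  linarith

theorem gh_max {n : ℕ} (hn : 1 ≤ n) (U : Set (EuclideanSpace ℝ (Fin n))) (hU : IsOpen U)
    (hUb : Bornology.IsBounded U) (w : EuclideanSpace ℝ (Fin n) → ℝ)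
    (hw : ContDiffOn ℝ 2 w U) (hwc : ContinuousOn w (closure U))
    (hl : ∀ x ∈ U, laplacian w x = 0) (hb : ∀ x ∈ frontier U, w x = 0) :
    ∀ x ∈ U, w x ≤ 0 := by
  intro x hx
  by_contra! hpos
  obtain ⟨R, hR0, hR⟩ := hUb.closure.exists_pos_norm_le
  set δ : ℝ := w x / (2 * R ^ 2) with hδ
  have hδ0 : 0 < δ := by positivity
  have hδR : δ * R ^ 2 = w x / 2 := by
    rw [hδ]; field_simp
  have hK : IsCompact (closure U) := hUb.isCompact_closure
  obtain ⟨y, hy, hmax⟩ := hK.exists_isMaxOn ⟨x, subset_closure hx⟩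
    (f := fun z => w z + δ * ‖z‖ ^ 2) (hwc.add (by fun_prop))
  have hxy : w x + δ * ‖x‖ ^ 2 ≤ w y + δ * ‖y‖ ^ 2 := hmax (subset_closure hx)
  have hyU : y ∈ U := by
    by_contra hyU
    have h0 := hb y (by rw [hU.frontier_eq]; exact ⟨hy, hyU⟩)
    have h1 : ‖y‖ ^ 2 ≤ R ^ 2 := by
      have := hR y hy
      gcongr
    have h2 : δ * ‖y‖ ^ 2 ≤ δ * R ^ 2 := by gcongr
    have h3 : 0 ≤ δ * ‖x‖ ^ 2 := by positivity
    linarith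
  have hloc : IsLocalMax (fun z => w z + δ * ‖z‖ ^ 2) y :=
    hmax.isLocalMax (Filter.mem_of_superset (hU.mem_nhds hyU) subset_closure)
  have hlt : laplacian w y < 0 := by
    unfold laplacian
    have : Nonempty (Fin n) := ⟨⟨0, hn⟩⟩
    apply Finset.sum_neg _ Finset.univ_nonempty
    intro i _
    have := gh_second_deriv w y (EuclideanSpace.single i 1) δ
      (hw.contDiffAt (hU.mem_nhds hyU)) hloc
    simp only [PiLp.norm_single, norm_one, one_pow] at this
    linarith
  linarith [hl y hyU]

theorem gh_lap_comb {n : ℕ} (V φ : EuclideanSpace ℝ (Fin n) → ℝ) (a b c : ℝ)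
    (x : EuclideanSpace ℝ (Fin n)) (hV : ContDiffAt ℝ 2 V x) (hφ : ContDiffAt ℝ 2 φ x) :
    laplacian (a • V + b • φ + fun _ => c) x = a * laplacian V x + b * laplacian φ x := by
  unfold laplacian
  rw [Finset.mul_sum, Finset.mul_sum, ← Finset.sum_add_distrib]
  refine Finset.sum_congr rfl fun i _ => ?_
  have h1 : ContDiffAt ℝ 2 (a • V) x := hV.const_smul a
  have h2 : ContDiffAt ℝ 2 (b • φ) x := hφ.const_smul b
  have h3 : ContDiffAt ℝ 2 (a • V + b • φ) x := h1.add h2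
  rw [iteratedFDeriv_add_apply h3 contDiffAt_const, iteratedFDeriv_add_apply h1 h2,
    iteratedFDeriv_const_smul_apply hV, iteratedFDeriv_const_smul_apply hφ,
    iteratedFDeriv_const_of_ne (by norm_num)]
  simp

/-- converse Gautreau–Hoffman theorem in the Newton–Coulomb theory:
if on a bounded open `U` the Poisson equations and the Gautreau–Hoffman condition
`β·ρ_e = ε·√G·ρ_m` hold, with `V, φ` continuous up to the closure, and
`V + ε·β·√G·φ − γ` vanishes on the frontier of `U`, then `V + ε·β·√G·φ = γ` on `U`. -/
theorem gautreau_hoffman_converse_newton {n : ℕ} (hn : 1 ≤ n)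
    (U : Set (EuclideanSpace ℝ (Fin n))) (hU : IsOpen U)
    (hUb : Bornology.IsBounded U)
    (V φ ρm ρe : EuclideanSpace ℝ (Fin n) → ℝ) (S G β γ ε : ℝ)
    (hS : 0 < S) (hG : 0 < G) (hε : ε = 1 ∨ ε = -1)
    (hV : ContDiffOn ℝ 2 V U) (hφ : ContDiffOn ℝ 2 φ U)
    (hVc : ContinuousOn V (closure U)) (hφc : ContinuousOn φ (closure U))
    (hpoisV : ∀ x ∈ U, laplacian V x = S * G * ρm x)
    (hpoisφ : ∀ x ∈ U, laplacian φ x = -(S * ρe x))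
    (hGH : ∀ x ∈ U, β * ρe x = ε * Real.sqrt G * ρm x)
    (hbdry : ∀ x ∈ frontier U, V x + ε * β * Real.sqrt G * φ x - γ = 0) :
    ∀ x ∈ U, V x + ε * β * Real.sqrt G * φ x = γ := by
  have hε2 : ε ^ 2 = 1 := by rcases hε with h | h <;> simp [h]
  have hG2 : Real.sqrt G ^ 2 = G := Real.sq_sqrt hG.le
  have key : ∀ s : ℝ, ∀ x ∈ U,
      (s • V + (s * (ε * β * Real.sqrt G)) • φ + fun _ => -(s * γ) : EuclideanSpace ℝ (Fin n) → ℝ) x ≤ 0 := by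
    intro s
    apply gh_max hn U hU hUb
    · exact ((hV.const_smul s).add (hφ.const_smul (s * (ε * β * Real.sqrt G)))).add contDiffOn_const
    · exact ((hVc.const_smul s).add (hφc.const_smul (s * (ε * β * Real.sqrt G)))).add continuousOn_const
    · intro x hx
      rw [gh_lap_comb _ _ _ _ _ _ (hV.contDiffAt (hU.mem_nhds hx))
        (hφ.contDiffAt (hU.mem_nhds hx)), hpoisV x hx, hpoisφ x hx]
      linear_combination (-s * ε * Real.sqrt G * S) * hGH x hx
        - s * S * ρm x * G * hε2 - s * S * ρm x * ε ^ 2 * hG2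
    · intro x hx
      simp only [Pi.add_apply, Pi.smul_apply, smul_eq_mul]
      linear_combination s * hbdry x hx
  intro x hx
  have h1 := key 1 x hx
  have h2 := key (-1) x hx
  simp only [Pi.add_apply, Pi.smul_apply, smul_eq_mul] at h1 h2
  linarith
end

section
/- Pressure formula for Newton–Coulomb Weyl-type fluids: let I ⊆ ℝ be an interval, V, p : ℝ → ℝ differentiable on I, ρ_m, ρ_e : ℝ → ℝ, G > 0, β ≠ 0 real constants and ε ∈ {−1, 1}. Suppose on I: V'(t) = −ε·β·√G; the equilibrium equation ρ_m(t)·V'(t) + ρ_e(t) + p'(t) = 0; and the Gautreau–Hoffman condition β·ρ_e(t) = ε·√G·ρ_m(t). Then p'(t) = (β² − 1)·ρ_e(t) for all t ∈ I; in particular, if β² = 1 then p is constant on I. -/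
/-- pressure formula for Newton–Coulomb Weyl-type fluids:
with the Weyl relation `V' = −ε·β·√G`, the equilibrium equation
`ρ_m·V' + ρ_e + p' = 0` and the Gautreau–Hoffman condition `β·ρ_e = ε·√G·ρ_m`,
one gets `p' = (β² − 1)·ρ_e` on the interval `I`; in particular if `β² = 1` then
the pressure is constant on `I`. -/
theorem newton_weyl_pressure_formula (I : Set ℝ) (hI : I.OrdConnected)
    (V p ρm ρe : ℝ → ℝ) (G β ε : ℝ) (hG : 0 < G) (hβ : β ≠ 0)
    (hε : ε = 1 ∨ ε = -1)
    (hV : ∀ t ∈ I, DifferentiableAt ℝ V t)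
    (hp : ∀ t ∈ I, DifferentiableAt ℝ p t)
    (hV' : ∀ t ∈ I, deriv V t = -ε * β * Real.sqrt G)
    (heq : ∀ t ∈ I, ρm t * deriv V t + ρe t + deriv p t = 0)
    (hGH : ∀ t ∈ I, β * ρe t = ε * Real.sqrt G * ρm t) :
    (∀ t ∈ I, deriv p t = (β ^ 2 - 1) * ρe t) ∧
    (β ^ 2 = 1 → ∀ s ∈ I, ∀ t ∈ I, p s = p t) := by
  have h1 : ∀ t ∈ I, deriv p t = (β ^ 2 - 1) * ρe t := by
    intro t ht
    have h := heq t ht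
    rw [hV' t ht] at h
    linear_combination h - β * hGH t ht
  refine ⟨h1, fun hb s hs t ht => ?_⟩
  have h2 := Convex.norm_image_sub_le_of_norm_deriv_le (C := 0) hp
    (fun x hx => by rw [h1 x hx, hb]; simp) hI.convex ht hs
  rw [zero_mul] at h2
  exact sub_eq_zero.mp (norm_le_zero_iff.mp h2)
end

section
/- Proportionality of mass and charge in the Weyl case a = 1: let d be a natural number with d ≥ 4, G > 0, and m, c, b, q, 𝔞 real numbers with q ≠ 0 and 𝔞 > 0. Define W₀² := 1 − 2·G·m/((d−3)·𝔞^(d−3)) + G·q²/((d−3)²·𝔞^(2(d−3))), and suppose the junction condition q²·(W₀² − c) = G·(m − q²/((d−3)·𝔞^(d−3)))² holds (the case a = 1). Then c = 1 − G·m²/q²; in particular, if in addition c = 1 − b², then b²·q² = G·m². -/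
/-- proportionality of mass and charge in the Weyl case `a = 1`:
with boundary metric potential
`W₀² = 1 − 2Gm/((d−3)𝔞^(d−3)) + Gq²/((d−3)²𝔞^(2(d−3)))`, the junction condition
`q²·(W₀² − c) = G·(m − q²/((d−3)·𝔞^(d−3)))²` yields `c = 1 − G·m²/q²`; in particular,
if in addition `c = 1 − b²`, then `b²·q² = G·m²`. -/
theorem weyl_mass_charge_proportionality (d : ℕ) (hd : 4 ≤ d)
    (G m c b q 𝔞 : ℝ) (hG : 0 < G) (hq : q ≠ 0) (h𝔞 : 0 < 𝔞)
    (W0sq : ℝ)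
    (hW0 : W0sq = 1 - 2 * G * m / (((d : ℝ) - 3) * 𝔞 ^ (d - 3))
        + G * q ^ 2 / (((d : ℝ) - 3) ^ 2 * 𝔞 ^ (2 * (d - 3))))
    (hjunction : q ^ 2 * (W0sq - c)
        = G * (m - q ^ 2 / (((d : ℝ) - 3) * 𝔞 ^ (d - 3))) ^ 2) :
    c = 1 - G * m ^ 2 / q ^ 2 ∧ (c = 1 - b ^ 2 → b ^ 2 * q ^ 2 = G * m ^ 2) := by
  have hX : ((d : ℝ) - 3) ^ 2 * 𝔞 ^ (2 * (d - 3)) = (((d : ℝ) - 3) * 𝔞 ^ (d - 3)) ^ 2 := by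
    rw [mul_pow, ← pow_mul, mul_comm 2 (d - 3)]
  rw [hX] at hW0
  generalize ((d : ℝ) - 3) * 𝔞 ^ (d - 3) = X at hW0 hjunction
  have key : q ^ 2 * (1 - c) = G * m ^ 2 := by
    subst hW0
    simp only [div_eq_mul_inv, ← inv_pow] at hjunction
    linear_combination hjunction
  refine ⟨?_, ?_⟩
  · have hq2 : q ^ 2 ≠ 0 := pow_ne_zero 2 hq
    rw [← key, mul_div_cancel_left₀ _ hq2]
    ring
  · intro hc
    rw [← key, hc]
    ring
end
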